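/- Let n ≥ 2 and k ≥ 2 be integers. If u : {1,…,2k} → ℝ is a harmonic solution for the lumped chain, then (n−1)·u(2i−1) + u(2i) = 1 for every i = 1,…,k−1. -/

import Mathlib

/-- Transition probabilities of the lumped chain on the states `{1,…,2k}`:
for `1 ≤ i ≤ k`,
`q(2i,2i−1) = 1/k`, `q(2i,2i−2) = (i−1)/k`, `q(2i,2i+2) = (k−i)/(k(n−1))`,
`q(2i,2i) = (k−i)(n−2)/(k(n−1))`, `q(2i−1,2i) = 1/(k(n−1))`,
`q(2i−1,2i+1) = (k−i)/(k(n−1))`, `q(2i−1,2i−3) = (i−1)/k`,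
`q(2i−1,2i−1) = (k−i+1)(n−2)/(k(n−1))`, and `q(m,m′) = 0` otherwise. -/
noncomputable def lumpedQ (n k : ℕ) (m m' : ℕ) : ℝ :=
  if m % 2 = 0 then
    let i := m / 2
    if m' = 2 * i - 1 then 1 / (k : ℝ)
    else if m' = 2 * i - 2 then ((i : ℝ) - 1) / (k : ℝ)
    else if m' = 2 * i + 2 then ((k : ℝ) - (i : ℝ)) / ((k : ℝ) * ((n : ℝ) - 1))
    else if m' = 2 * i then ((k : ℝ) - (i : ℝ)) * ((n : ℝ) - 2) / ((k : ℝ) * ((n : ℝ) - 1))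
    else 0
  else
    let i := (m + 1) / 2
    if m' = 2 * i then 1 / ((k : ℝ) * ((n : ℝ) - 1))
    else if m' = 2 * i + 1 then ((k : ℝ) - (i : ℝ)) / ((k : ℝ) * ((n : ℝ) - 1))
    else if m' = 2 * i - 3 then ((i : ℝ) - 1) / (k : ℝ)
    else if m' = 2 * i - 1 then
      ((k : ℝ) - (i : ℝ) + 1) * ((n : ℝ) - 2) / ((k : ℝ) * ((n : ℝ) - 1))
    else 0

/-- `u` is a harmonic solution for the lumped chain: `u(2k−1) = 0`, `u(2k) = 1`, and
`u(m) = ∑_{m'=1}^{2k} q(m,m')·u(m')` for every `1 ≤ m ≤ 2k−2`; `u(m)` is the probability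
of hitting state `2k` before state `2k−1` starting from `m`. -/
def IsHarmonicSol (n k : ℕ) (u : ℕ → ℝ) : Prop :=
  u (2 * k - 1) = 0 ∧ u (2 * k) = 1 ∧
    ∀ m, 1 ≤ m → m ≤ 2 * k - 2 →
      u m = ∑ m' ∈ Finset.Icc 1 (2 * k), lumpedQ n k m m' * u m'

/-- A sum whose summand is supported on four distinct indices. -/
theorem sum_ite_four (s : Finset ℕ) (a b c d : ℕ) (p q r t : ℝ) (v f : ℕ → ℝ)
    (hf : ∀ m, f m = if m = a then p else if m = b then q else if m = c then r
      else if m = d then t else 0)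
    (hab : a ≠ b) (hac : a ≠ c) (had : a ≠ d) (hbc : b ≠ c) (hbd : b ≠ d) (hcd : c ≠ d) :
    ∑ m ∈ s, f m * v m =
      (if a ∈ s then p * v a else 0) + (if b ∈ s then q * v b else 0) +
      (if c ∈ s then r * v c else 0) + (if d ∈ s then t * v d else 0) := by
  have h : ∀ m ∈ s, f m * v m =
      (if a = m then p * v m else 0) + (if b = m then q * v m else 0) +
      (if c = m then r * v m else 0) + (if d = m then t * v m else 0) := by
    intro m _
    rw [hf]
    split_ifs <;> first | omega | ring
  rw [Finset.sum_congr rfl h]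
  simp only [Finset.sum_add_distrib, Finset.sum_ite_eq]

/-- The harmonic equation at an even state, with denominators cleared. -/
theorem IsHarmonicSol.even_eq {n k : ℕ} (hn : 2 ≤ n) {u : ℕ → ℝ} (hu : IsHarmonicSol n k u)
    (j : ℕ) (hj : j + 2 ≤ k) :
    (k : ℝ) * ((n : ℝ) - 1) * u (2 * j + 2) =
      ((n : ℝ) - 1) * u (2 * j + 1) + ((n : ℝ) - 1) * j * u (2 * j) +
      ((k : ℝ) - (j + 1)) * u (2 * j + 4) +
      ((k : ℝ) - (j + 1)) * ((n : ℝ) - 2) * u (2 * j + 2) := by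
  have hn1 : (n : ℝ) - 1 ≠ 0 := by
    have : (2 : ℝ) ≤ n := by exact_mod_cast hn
    linarith
  have hk0 : (k : ℝ) ≠ 0 := by
    have : k ≠ 0 := by omega
    exact_mod_cast this
  have h := hu.2.2 (2 * j + 2) (by omega) (by omega)
  rw [sum_ite_four _ (2 * j + 1) (2 * j) (2 * j + 4) (2 * j + 2)
    (1 / (k : ℝ)) ((j : ℝ) / k) (((k : ℝ) - (j + 1)) / (k * ((n : ℝ) - 1)))
    (((k : ℝ) - (j + 1)) * ((n : ℝ) - 2) / (k * ((n : ℝ) - 1))) u (lumpedQ n k (2 * j + 2))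
    ?_ (by omega) (by omega) (by omega) (by omega) (by omega) (by omega)] at h
  · rw [if_pos (c := 2 * j + 1 ∈ _) (by simp; omega), if_pos (c := 2 * j + 4 ∈ _) (by simp; omega),
      if_pos (c := 2 * j + 2 ∈ _) (by simp; omega)] at h
    have hb : (if 2 * j ∈ Finset.Icc 1 (2 * k) then (j : ℝ) / k * u (2 * j) else 0) =
        (j : ℝ) / k * u (2 * j) := by
      rcases Nat.eq_zero_or_pos j with rfl | hpos
      · simp
      · exact if_pos (by simp; omega)
    rw [hb] at h
    field_simp at h
    linear_combination h
  · intro m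
    have e : (2 * j + 2) % 2 = 0 := by omega
    have e2 : (2 * j + 2) / 2 = j + 1 := by omega
    have e3 : 2 * (j + 1) - 1 = 2 * j + 1 := by omega
    have e4 : 2 * (j + 1) - 2 = 2 * j := by omega
    have e5 : 2 * (j + 1) + 2 = 2 * j + 4 := by omega
    have e6 : 2 * (j + 1) = 2 * j + 2 := by omega
    simp only [lumpedQ, e, e2, e3, e4, e5, if_true]
    simp only [e6]
    push_cast
    simp only [add_sub_cancel_right]

/-- The harmonic equation at an odd state, with denominators cleared. -/
theorem IsHarmonicSol.odd_eq {n k : ℕ} (hn : 2 ≤ n) {u : ℕ → ℝ} (hu : IsHarmonicSol n k u)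
    (j : ℕ) (hj : j + 2 ≤ k) :
    (k : ℝ) * ((n : ℝ) - 1) * u (2 * j + 1) =
      u (2 * j + 2) + ((k : ℝ) - (j + 1)) * u (2 * j + 3) +
      ((n : ℝ) - 1) * j * u (2 * j - 1) +
      ((k : ℝ) - (j + 1) + 1) * ((n : ℝ) - 2) * u (2 * j + 1) := by
  have hn1 : (n : ℝ) - 1 ≠ 0 := by
    have : (2 : ℝ) ≤ n := by exact_mod_cast hn
    linarith
  have hk0 : (k : ℝ) ≠ 0 := by
    have : k ≠ 0 := by omega
    exact_mod_cast this
  have h := hu.2.2 (2 * j + 1) (by omega) (by omega)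
  rw [sum_ite_four _ (2 * j + 2) (2 * j + 3) (2 * j - 1) (2 * j + 1)
    (1 / (k * ((n : ℝ) - 1))) (((k : ℝ) - (j + 1)) / (k * ((n : ℝ) - 1))) ((j : ℝ) / k)
    (((k : ℝ) - (j + 1) + 1) * ((n : ℝ) - 2) / (k * ((n : ℝ) - 1))) u (lumpedQ n k (2 * j + 1))
    ?_ (by omega) (by omega) (by omega) (by omega) (by omega) (by omega)] at h
  · rw [if_pos (by simp; omega), if_pos (by simp; omega),
      if_pos (c := 2 * j + 1 ∈ _) (by simp; omega)] at h
    have hb : (if 2 * j - 1 ∈ Finset.Icc 1 (2 * k) then (j : ℝ) / k * u (2 * j - 1) else 0) =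
        (j : ℝ) / k * u (2 * j - 1) := by
      rcases Nat.eq_zero_or_pos j with rfl | hpos
      · simp
      · exact if_pos (by simp; omega)
    rw [hb] at h
    field_simp at h
    linear_combination h
  · intro m
    have e : (2 * j + 1) % 2 = 1 := by omega
    have e2 : (2 * j + 1 + 1) / 2 = j + 1 := by omega
    have e3 : 2 * (j + 1) - 1 = 2 * j + 1 := by omega
    have e4 : 2 * (j + 1) - 3 = 2 * j - 1 := by omega
    have e5 : 2 * (j + 1) + 1 = 2 * j + 3 := by omega
    have e6 : 2 * (j + 1) = 2 * j + 2 := by omega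
    simp only [lumpedQ, e, e2, e3, e4, e5, one_ne_zero, if_false]
    simp only [e6]
    push_cast
    simp only [add_sub_cancel_right]

/-- The combination `(n - 1) u(2i - 1) + u(2i)` does not depend on `i`. -/
theorem IsHarmonicSol.combination_succ {n k : ℕ} (hn : 2 ≤ n) {u : ℕ → ℝ}
    (hu : IsHarmonicSol n k u) (j : ℕ) (hj : j + 2 ≤ k) :
    ((n : ℝ) - 1) * u (2 * j + 3) + u (2 * j + 4) =
      ((n : ℝ) - 1) * u (2 * j + 1) + u (2 * j + 2) := by
  have hpos : (k : ℝ) - (j + 1) ≠ 0 := by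
    have : (j : ℝ) + 2 ≤ k := by exact_mod_cast hj
    linarith
  have ho := hu.odd_eq hn j hj
  have he := hu.even_eq hn j hj
  apply mul_left_cancel₀ hpos
  induction j with
  | zero =>
    push_cast at ho he ⊢
    linear_combination -((n : ℝ) - 1) * ho - he
  | succ j ih =>
    have hpos' : (k : ℝ) - (j + 1) ≠ 0 := by
      have : (j : ℝ) + 1 + 2 ≤ k := by exact_mod_cast hj
      linarith
    have ih := mul_left_cancel₀ hpos'
      (ih (by omega) hpos' (hu.odd_eq hn j (by omega)) (hu.even_eq hn j (by omega)))
    rw [show 2 * (j + 1) - 1 = 2 * j + 1 by omega] at ho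
    simp only [show 2 * (j + 1) = 2 * j + 2 by omega, Nat.add_assoc, Nat.reduceAdd] at ho he ⊢
    push_cast at ho he ⊢
    linear_combination -((n : ℝ) - 1) * ho - he + ((n : ℝ) - 1) * (j + 1) * ih

theorem stmt_18 (n k : ℕ) (hn : 2 ≤ n) (hk : 2 ≤ k)
    (u : ℕ → ℝ) (hu : IsHarmonicSol n k u) :
    ∀ i, 1 ≤ i → i ≤ k - 1 →
      ((n : ℝ) - 1) * u (2 * i - 1) + u (2 * i) = 1 := by
  intro i hi hik
  have key : ∀ j, j + 1 ≤ k → ((n : ℝ) - 1) * u (2 * (k - j) - 1) + u (2 * (k - j)) = 1 := by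
    intro j hj
    induction j with
    | zero => simp [hu.1, hu.2.1]
    | succ j ih =>
      have h := hu.combination_succ hn (k - (j + 2)) (by omega)
      refine Eq.trans ?_ (ih (by omega))
      rw [show 2 * (k - j) - 1 = 2 * (k - (j + 2)) + 3 by omega,
        show 2 * (k - j) = 2 * (k - (j + 2)) + 4 by omega,
        show 2 * (k - (j + 1)) - 1 = 2 * (k - (j + 2)) + 1 by omega,
        show 2 * (k - (j + 1)) = 2 * (k - (j + 2)) + 2 by omega]
      exact h.symm
  have h := key (k - i) (by omega)
  rwa [show k - (k - i) = i by omega] at h
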